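/- Let π = (π_k)_{k≥0} be a probability distribution on ℕ with mean m ∈ (0,∞) and π₀ + π₁ < 1, and let M(z) = φ(z) + (1−z)φ'(z) + φ(1−φ̂(z)) − 1 on [0,1]. If z ∈ [0,1] satisfies the fixed-point equation z = 1 − φ̂(1 − φ̂(z)), then M(1 − φ̂(z)) = M(z). In particular, the set of maximizers of M on [0,1] is stable under the map z ↦ 1 − φ̂(z). -/

import Mathlib

open Filter Topology Set

/-- Generating function `φ(z) = Σ πₖ zᵏ` of a distribution on ℕ. -/
noncomputable def genFun (p : ℕ → ℝ) (z : ℝ) : ℝ := ∑' k : ℕ, p k * z ^ k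

/-- Derivative series `φ'(z) = Σ (k+1) π_{k+1} zᵏ`. -/
noncomputable def genFunD (p : ℕ → ℝ) (z : ℝ) : ℝ :=
  ∑' k : ℕ, ((k : ℝ) + 1) * p (k + 1) * z ^ k

/-- Generating function `φ̂(z) = Σ π̂ₖ zᵏ = φ'(z)/m` of the size-biased distribution
`π̂ₖ = (k+1)π_{k+1}/m`. -/
noncomputable def genFunHat (p : ℕ → ℝ) (m : ℝ) (z : ℝ) : ℝ := genFunD p z / m

/-- Derivative series `φ̂'(z) = Σ (k+1) π̂_{k+1} zᵏ = Σ (k+1)(k+2) π_{k+2}/m · zᵏ`. -/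
noncomputable def genFunHatD (p : ℕ → ℝ) (m : ℝ) (z : ℝ) : ℝ :=
  ∑' k : ℕ, ((k : ℝ) + 1) * (((k : ℝ) + 2) * p (k + 2) / m) * z ^ k

/-- The function `M(z) = φ(z) + (1−z)φ'(z) + φ(1−φ̂(z)) − 1` from
Bordenave–Lelarge–Salez, whose maximum over `[0,1]` equals the spectral mass at zero. -/
noncomputable def Mfun (p : ℕ → ℝ) (m : ℝ) (z : ℝ) : ℝ :=
  genFun p z + (1 - z) * genFunD p z + genFun p (1 - genFunHat p m z) - 1

/-- The monomial `x ^ (n + 1)` lies above its tangent line at `z` on `[0, ∞)`. -/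
lemma pow_succ_tangent_le {x z : ℝ} (hx : 0 ≤ x) (hz : 0 ≤ z) (n : ℕ) :
    z ^ (n + 1) + ((n : ℝ) + 1) * z ^ n * (x - z) ≤ x ^ (n + 1) := by
  induction n with
  | zero => simp
  | succ n ih =>
    have h₁ := mul_le_mul_of_nonneg_right ih hx
    have h₂ : 0 ≤ ((n : ℝ) + 1) * z ^ n * (x - z) ^ 2 := by positivity
    push_cast
    simp only [pow_succ] at *
    linarith

lemma summable_mul_pow_of_mem_Icc {a : ℕ → ℝ} (ha0 : ∀ k, 0 ≤ a k) (ha : Summable a) {z : ℝ}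
    (hz : z ∈ Set.Icc (0 : ℝ) 1) : Summable fun k => a k * z ^ k :=
  ha.of_nonneg_of_le (fun k => mul_nonneg (ha0 k) (pow_nonneg hz.1 k))
    (fun k => mul_le_of_le_one_right (ha0 k) (pow_le_one₀ hz.1 hz.2))

lemma summable_succ_mul {p : ℕ → ℝ} (hp : Summable fun k : ℕ => (k : ℝ) * p k) :
    Summable fun k : ℕ => ((k : ℝ) + 1) * p (k + 1) := by
  simpa using (summable_nat_add_iff 1).2 hp

/-- A generating function lies above its tangent lines on `[0, 1]`. -/
lemma genFun_tangent_le {p : ℕ → ℝ} (hp0 : ∀ k, 0 ≤ p k) (hp : Summable p)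
    (hmean : Summable fun k : ℕ => (k : ℝ) * p k) {x z : ℝ}
    (hx : x ∈ Set.Icc (0 : ℝ) 1) (hz : z ∈ Set.Icc (0 : ℝ) 1) :
    genFun p z + genFunD p z * (x - z) ≤ genFun p x := by
  have hsx := summable_mul_pow_of_mem_Icc hp0 hp hx
  have hsz := summable_mul_pow_of_mem_Icc hp0 hp hz
  have hsD := summable_mul_pow_of_mem_Icc
    (fun k => mul_nonneg (by positivity) (hp0 (k + 1))) (summable_succ_mul hmean) hz
  have hsx' := (summable_nat_add_iff 1).2 hsx
  have hsz' := (summable_nat_add_iff 1).2 hsz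
  have hsD' := hsD.mul_right (x - z)
  unfold genFun genFunD
  rw [hsx.tsum_eq_zero_add, hsz.tsum_eq_zero_add, ← tsum_mul_right, add_assoc,
    ← hsz'.tsum_add hsD']
  simp only [pow_zero]
  refine add_le_add le_rfl ?_
  refine (hsz'.add hsD').tsum_le_tsum (fun k => ?_) hsx'
  linarith [mul_le_mul_of_nonneg_left (pow_succ_tangent_le hx.1 hz.1 k) (hp0 (k + 1))]

lemma genFunHat_mem_Icc {p : ℕ → ℝ} (hp0 : ∀ k, 0 ≤ p k) {m : ℝ}
    (hm : m = ∑' k : ℕ, (k : ℝ) * p k) (hmpos : 0 < m)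
    (hmean : Summable fun k : ℕ => (k : ℝ) * p k) {z : ℝ} (hz : z ∈ Set.Icc (0 : ℝ) 1) :
    genFunHat p m z ∈ Set.Icc (0 : ℝ) 1 := by
  have h0 : ∀ k : ℕ, 0 ≤ ((k : ℝ) + 1) * p (k + 1) :=
    fun k => mul_nonneg (by positivity) (hp0 (k + 1))
  have hm' : m = ∑' k : ℕ, ((k : ℝ) + 1) * p (k + 1) := by
    rw [hm, hmean.tsum_eq_zero_add]
    simp
  refine ⟨div_nonneg (tsum_nonneg fun k => mul_nonneg (h0 k) (pow_nonneg hz.1 k)) hmpos.le,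
    (div_le_one hmpos).2 ?_⟩
  rw [hm']
  exact (summable_mul_pow_of_mem_Icc h0 (summable_succ_mul hmean) hz).tsum_le_tsum
    (fun k => mul_le_of_le_one_right (h0 k) (pow_le_one₀ hz.1 hz.2)) (summable_succ_mul hmean)

/-- The map `z ↦ 1 - φ̂(z)` does not decrease `M`: both values of `M` come from the symmetric
function `φ(x) + φ(w) + m (1 - x) (1 - w) - 1`, which at `w = 1 - φ̂(z)` is minimal in `x = z`. -/
lemma Mfun_le_Mfun_one_sub_genFunHat {p : ℕ → ℝ} (hp0 : ∀ k, 0 ≤ p k) (hp : Summable p) {m : ℝ}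
    (hm : m = ∑' k : ℕ, (k : ℝ) * p k) (hmpos : 0 < m)
    (hmean : Summable fun k : ℕ => (k : ℝ) * p k) {z : ℝ} (hz : z ∈ Set.Icc (0 : ℝ) 1) :
    Mfun p m z ≤ Mfun p m (1 - genFunHat p m z) := by
  have hD : ∀ x, genFunD p x = m * genFunHat p m x := fun x => by
    unfold genFunHat
    field_simp
  have hw := Set.Icc.mem_iff_one_sub_mem.1 (genFunHat_mem_Icc hp0 hm hmpos hmean hz)
  have hx := Set.Icc.mem_iff_one_sub_mem.1 (genFunHat_mem_Icc hp0 hm hmpos hmean hw)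
  have h := genFun_tangent_le hp0 hp hmean hx hz
  unfold Mfun
  rw [hD] at h ⊢
  rw [hD]
  linarith

/-- With `π` a probability distribution on ℕ of mean `m ∈ (0,∞)` and
`π₀ + π₁ < 1`: if `z ∈ [0,1]` satisfies `z = 1 − φ̂(1 − φ̂(z))` then
`M(1 − φ̂(z)) = M(z)`; in particular, the set of maximizers of `M` on `[0,1]` is
stable under `z ↦ 1 − φ̂(z)`. -/
theorem stmt_13 (p : ℕ → ℝ) (hp0 : ∀ k, 0 ≤ p k) (hp1 : ∑' k : ℕ, p k = 1)
    (m : ℝ) (hm : m = ∑' k : ℕ, (k : ℝ) * p k) (hmpos : 0 < m)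
    (hmfin : Summable fun k : ℕ => (k : ℝ) * p k) (hdeg : p 0 + p 1 < 1) :
    (∀ z ∈ Set.Icc (0 : ℝ) 1, z = 1 - genFunHat p m (1 - genFunHat p m z) →
        Mfun p m (1 - genFunHat p m z) = Mfun p m z) ∧
      ∀ z ∈ Set.Icc (0 : ℝ) 1, IsMaxOn (Mfun p m) (Set.Icc 0 1) z →
        IsMaxOn (Mfun p m) (Set.Icc 0 1) (1 - genFunHat p m z) := by
  refine ⟨fun z _ hfix => ?_, fun z hz hmax x hx => ?_⟩
  · have hD : ∀ x, genFunD p x = m * genFunHat p m x := fun x => by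
      unfold genFunHat
      field_simp
    unfold Mfun
    rw [hD, hD, ← hfix]
    linear_combination m * genFunHat p m z * hfix
  · have hp : Summable p := by
      by_contra h
      simp [tsum_eq_zero_of_not_summable h] at hp1
    exact (hmax hx).trans (Mfun_le_Mfun_one_sub_genFunHat hp0 hp hm hmpos hmfin hz)
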